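/- arXiv:2407.02090 — 8 statements merged into one kernel-verified Lean document; each statement's English description precedes it below -/
import Mathlib

section
/- Let X be a finite nonempty state space, U a finite action set, f : X × U → X a transition function, and x_I ∈ X. If (u_n)_{n≥1} is a rich sequence over U and the trajectory is defined by x_1 = x_I and x_{n+1} = f(x_n, u_n), then there exist an essential class S ⊆ X and N ∈ ℕ such that x_n ∈ S for all n ≥ N, and every state of S equals x_n for infinitely many indices n. -/
/-- `x'` is reachable from `x` under transition function `f` if some finite
action sequence takes `x` to `x'`. -/
def Reachable {X U : Type*} (f : X → U → X) (x x' : X) : Prop :=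
  ∃ l : List U, l.foldl f x = x'

/-- An essential class is a maximal set of states all reachable from each other. -/
def IsEssentialClass {X U : Type*} (f : X → U → X) (S : Set X) : Prop :=
  (∀ x ∈ S, ∀ y ∈ S, Reachable f x y) ∧
  ∀ S' : Set X, S ⊆ S' → (∀ x ∈ S', ∀ y ∈ S', Reachable f x y) → S' = S

open Filter in
/-- A sequence with values in a finite type eventually takes only values attained
infinitely often. -/
theorem eventually_infinite_fiber {X : Type*} [Finite X] (x : ℕ → X) :
    ∀ᶠ n in atTop, {m : ℕ | x m = x n}.Infinite := by
  have h : ∀ s : X, ∀ᶠ n in atTop, x n = s → {m : ℕ | x m = s}.Infinite := by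
    intro s
    by_cases hs : {m : ℕ | x m = s}.Infinite
    · exact Eventually.of_forall fun _ _ => hs
    · rw [← Nat.cofinite_eq_atTop]
      filter_upwards [(Set.not_infinite.1 hs).compl_mem_cofinite] with n hn hns
      exact absurd hns hn
  filter_upwards [eventually_all.2 h] with n hn using hn _ rfl

section Trajectory

variable {X U : Type*} {f : X → U → X} {u : ℕ → U} {x : ℕ → X}

theorem foldl_ofFn_trajectory (hxs : ∀ n, x (n + 1) = f (x n) (u n)) (n k : ℕ) :
    (List.ofFn fun i : Fin k => u (n + i)).foldl f (x n) = x (n + k) := by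
  induction k with
  | zero => simp
  | succ k ih =>
    rw [List.ofFn_succ_last, List.foldl_append]
    simp only [Fin.val_castSucc, Fin.val_last, List.foldl_cons, List.foldl_nil]
    rw [ih, ← hxs, add_assoc]

theorem reachable_trajectory (hxs : ∀ n, x (n + 1) = f (x n) (u n)) {m n : ℕ} (h : m ≤ n) :
    Reachable f (x m) (x n) := by
  obtain ⟨k, rfl⟩ := Nat.exists_eq_add_of_le h
  exact ⟨_, foldl_ofFn_trajectory hxs m k⟩

/-- If every state can be steered into `P`, then a single word visits `P` from each state
of a given finite set. -/
theorem exists_word_visiting {P : X → Prop} (hP : ∀ s, ∃ l : List U, P (l.foldl f s))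
    (F : Finset X) : ∃ w : List U, ∀ s ∈ F, ∃ p, p <+: w ∧ P (p.foldl f s) := by
  classical
  induction F using Finset.induction_on with
  | empty => exact ⟨[], by simp⟩
  | insert a F _ ih =>
    obtain ⟨w, hw⟩ := ih
    obtain ⟨l, hl⟩ := hP (w.foldl f a)
    refine ⟨w ++ l, fun s hs => ?_⟩
    rcases Finset.mem_insert.1 hs with rfl | hs
    · exact ⟨w ++ l, List.prefix_rfl, by rwa [List.foldl_append]⟩
    · obtain ⟨p, hp, hPp⟩ := hw s hs
      exact ⟨p, hp.trans (List.prefix_append w l), hPp⟩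

/-- Every finite word occurs in a rich sequence arbitrarily late. -/
theorem exists_late_occurrence
    (hrich : ∀ w : List U, ∃ n : ℕ, (List.ofFn fun i : Fin w.length => u (n + i)) = w)
    (N : ℕ) (w : List U) :
    ∃ n, N ≤ n ∧ (List.ofFn fun i : Fin w.length => u (n + i)) = w := by
  obtain ⟨n, hn⟩ := hrich (List.replicate N (u 0) ++ w)
  refine ⟨n + N, Nat.le_add_left _ _, List.ext_getElem (by simp) fun i hi hi' => ?_⟩
  have h := List.getElem_of_eq hn (i := N + i) (by simpa using hi')
  simpa [List.getElem_append_right, add_assoc] using h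

/-- If every state can be steered into `P`, then the trajectory of a rich sequence visits `P`
arbitrarily late. -/
theorem exists_late_visit [Finite X]
    (hrich : ∀ w : List U, ∃ n : ℕ, (List.ofFn fun i : Fin w.length => u (n + i)) = w)
    (hxs : ∀ n, x (n + 1) = f (x n) (u n)) {P : X → Prop}
    (hP : ∀ s, ∃ l : List U, P (l.foldl f s)) (N : ℕ) : ∃ n, N ≤ n ∧ P (x n) := by
  have := Fintype.ofFinite X
  obtain ⟨w, hw⟩ := exists_word_visiting hP Finset.univ
  obtain ⟨n, hn, hnw⟩ := exists_late_occurrence hrich N w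
  obtain ⟨p, hp, hPp⟩ := hw (x n) (Finset.mem_univ _)
  refine ⟨n + p.length, by omega, ?_⟩
  rw [← foldl_ofFn_trajectory hxs]
  convert hPp
  refine List.ext_getElem (by simp) fun i hi hi' => ?_
  have h := List.getElem_of_eq hnw (i := i) (by simpa using hi'.trans_le hp.length_le)
  rw [hp.getElem hi']
  simpa using h

end Trajectory

/-- **Rich plans converge to essential classes.**  If the action sequence `u` is rich
(every finite word over `U` occurs contiguously), then the trajectory eventually enters
an essential class `S` and visits every state of `S` infinitely often. -/
theorem stmt0 {X U : Type*} [Finite X] [Nonempty X] [Finite U]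
    (f : X → U → X) (xI : X) (u : ℕ → U)
    (hrich : ∀ w : List U, ∃ n : ℕ, (List.ofFn fun i : Fin w.length => u (n + i)) = w)
    (x : ℕ → X) (hx0 : x 0 = xI) (hxs : ∀ n, x (n + 1) = f (x n) (u n)) :
    ∃ S : Set X, IsEssentialClass f S ∧ ∃ N : ℕ,
      (∀ n, N ≤ n → x n ∈ S) ∧ ∀ s ∈ S, {n : ℕ | x n = s}.Infinite := by
  obtain ⟨N, hN⟩ := Filter.eventually_atTop.1 (eventually_infinite_fiber x)
  refine ⟨{s | {n : ℕ | x n = s}.Infinite}, ⟨?_, fun S' hS hS' => ?_⟩, N, hN, fun _ hs => hs⟩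
  · intro s hs t ht
    obtain ⟨m, rfl⟩ := hs.nonempty
    obtain ⟨n, rfl, hmn⟩ := ht.exists_gt m
    exact reachable_trajectory hxs hmn.le
  · refine Set.Subset.antisymm (fun t ht => ?_) hS
    have hP : ∀ s, ∃ l : List U,
        l.foldl f s = t ∨ ¬ {n : ℕ | x n = l.foldl f s}.Infinite := by
      intro s
      by_cases hs : {n : ℕ | x n = s}.Infinite
      · obtain ⟨l, hl⟩ := hS' s (hS hs) t ht
        exact ⟨l, Or.inl hl⟩
      · exact ⟨[], Or.inr hs⟩
    obtain ⟨n, hn, h⟩ := exists_late_visit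
      (P := fun s => s = t ∨ ¬ {n : ℕ | x n = s}.Infinite) hrich hxs hP N
    rcases h with rfl | h
    · exact hN n hn
    · exact absurd (hN n hn) h
end

section
/- Let (X, U, f) be a robot grid search problem and k ∈ ℕ. Consider the automaton with state set X × U^k and transition function f̂((x,(u_1,…,u_k)), u) := (f(x,u_1), (u_2,…,u_k,u)) for u ∈ U. Then X × U^k is strongly connected under f̂: for any two states ẑ, ẑ' ∈ X × U^k there exists a finite sequence of actions in U whose successive application by f̂ takes ẑ to ẑ'. -/
/-- The four unit-length grid actions `left, right, up, down`. -/
def Ugrid : Set (ℤ × ℤ) := {(-1, 0), (1, 0), (0, 1), (0, -1)}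

/-- A subset `Z ⊆ ℤ×ℤ` is a connected grid if any two of its points are joined by
a finite chain of points of `Z` in which consecutive points are at (Euclidean)
distance `1`, i.e. the coordinate differences have absolute values summing to `1`. -/
def ConnectedGrid (Z : Set (ℤ × ℤ)) : Prop :=
  ∀ z1 ∈ Z, ∀ z2 ∈ Z, ∃ n : ℕ, ∃ x : Fin (n + 1) → ℤ × ℤ,
    (∀ k, x k ∈ Z) ∧ x 0 = z1 ∧ x (Fin.last n) = z2 ∧
    ∀ k : Fin n, ((x k.succ).1 - (x k.castSucc).1).natAbs
      + ((x k.succ).2 - (x k.castSucc).2).natAbs = 1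

/-- The stay-put transition function: `f(x,u) = x + u` if `x + u ∈ X`, else `x`. -/
noncomputable def fstep (X : Set (ℤ × ℤ)) (x u : ℤ × ℤ) : ℤ × ℤ :=
  @ite _ (x + u ∈ X) (Classical.propDecidable _) (x + u) x

/-- The transition function of the automaton on `X × U^k`: the state stores the
current position together with a buffer of the next `k` actions; a new action `u`
enters the back of the buffer while the front action is applied to the position. -/
noncomputable def fhat (X : Set (ℤ × ℤ)) (k : ℕ)
    (z : (ℤ × ℤ) × (Fin k → ℤ × ℤ)) (u : ℤ × ℤ) : (ℤ × ℤ) × (Fin k → ℤ × ℤ) :=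
  ((if h : 0 < k then fstep X z.1 (z.2 ⟨0, h⟩) else fstep X z.1 u),
   fun i => if h : (i : ℕ) + 1 < k then z.2 ⟨(i : ℕ) + 1, h⟩ else u)

theorem fstep_mem {X : Set (ℤ × ℤ)} {x : ℤ × ℤ} (hx : x ∈ X) (u : ℤ × ℤ) : fstep X x u ∈ X := by
  unfold fstep
  split_ifs with h
  · exact h
  · exact hx

theorem foldl_fstep_mem {X : Set (ℤ × ℤ)} (l : List (ℤ × ℤ)) {x : ℤ × ℤ} (hx : x ∈ X) :
    l.foldl (fstep X) x ∈ X := by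
  induction l generalizing x with
  | nil => exact hx
  | cons u l ih => exact ih (fstep_mem hx u)

theorem sub_mem_Ugrid {x y : ℤ × ℤ} (h : (y.1 - x.1).natAbs + (y.2 - x.2).natAbs = 1) :
    y - x ∈ Ugrid := by
  simp only [Ugrid, Set.mem_insert_iff, Set.mem_singleton_iff, Prod.ext_iff, Prod.fst_sub,
    Prod.snd_sub]
  omega

theorem ConnectedGrid.exists_foldl_fstep {X : Set (ℤ × ℤ)} (hX : ConnectedGrid X) {x y : ℤ × ℤ}
    (hx : x ∈ X) (hy : y ∈ X) :
    ∃ l : List (ℤ × ℤ), (∀ u ∈ l, u ∈ Ugrid) ∧ l.foldl (fstep X) x = y := by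
  obtain ⟨n, c, hc, rfl, rfl, hstep⟩ := hX x hx y hy
  generalize Fin.last n = j
  induction j using Fin.induction with
  | zero => exact ⟨[], by simp, rfl⟩
  | succ i ih =>
    obtain ⟨l, hl, hli⟩ := ih
    refine ⟨l ++ [c i.succ - c i.castSucc], ?_, ?_⟩
    · intro u hu
      rcases List.mem_append.1 hu with hu | hu
      · exact hl u hu
      · rw [List.mem_singleton.1 hu]
        exact sub_mem_Ugrid (hstep i)
    · simp [hli, fstep, hc i.succ]

/-- One step of `fhat` pops the front of the buffer, extended by the new action, and applies it to
the position. -/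
theorem exists_fhat_eq (X : Set (ℤ × ℤ)) (k : ℕ) (z : (ℤ × ℤ) × (Fin k → ℤ × ℤ)) (u : ℤ × ℤ) :
    ∃ v, List.ofFn z.2 ++ [u] = v :: List.ofFn (fhat X k z u).2 ∧
      (fhat X k z u).1 = fstep X z.1 v := by
  cases k with
  | zero => exact ⟨u, by simp [fhat]⟩
  | succ k =>
    refine ⟨z.2 0, ?_, by simp [fhat]⟩
    rw [List.ofFn_succ, List.ofFn_succ_last (f := (fhat X (k + 1) z u).2)]
    simp [fhat, Fin.succ]

theorem foldl_fhat_eq (X : Set (ℤ × ℤ)) (k : ℕ) (w c : List (ℤ × ℤ))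
    (z : (ℤ × ℤ) × (Fin k → ℤ × ℤ)) (b : Fin k → ℤ × ℤ)
    (h : List.ofFn z.2 ++ w = c ++ List.ofFn b) :
    w.foldl (fhat X k) z = (c.foldl (fstep X) z.1, b) := by
  induction w generalizing c z with
  | nil =>
    have hc : c = [] := by
      have := congrArg List.length h
      simpa using this
    subst hc
    have hb : z.2 = b := List.ofFn_injective (by simpa using h)
    simp [← hb]
  | cons u w ih =>
    obtain ⟨v, hv, hpos⟩ := exists_fhat_eq X k z u
    cases c with
    | nil =>
      have := congrArg List.length h
      simp at this
    | cons v' c =>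
      rw [← List.singleton_append, ← List.append_assoc, hv, List.cons_append, List.cons_append,
        List.cons.injEq] at h
      rw [List.foldl_cons, ih c _ h.2, hpos, h.1, List.foldl_cons]

/-- **Essential class of finite trajectories.**  For a robot grid search problem,
the automaton on `X × U^k` with transition `fhat` is strongly connected. -/
theorem stmt1 (X : Set (ℤ × ℤ)) (hfin : X.Finite) (hne : X.Nonempty)
    (hconn : ConnectedGrid X) (k : ℕ)
    (z z' : (ℤ × ℤ) × (Fin k → ℤ × ℤ))
    (hz1 : z.1 ∈ X) (hz2 : ∀ i, z.2 i ∈ Ugrid)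
    (hz1' : z'.1 ∈ X) (hz2' : ∀ i, z'.2 i ∈ Ugrid) :
    ∃ l : List (ℤ × ℤ), (∀ u ∈ l, u ∈ Ugrid) ∧ l.foldl (fhat X k) z = z' := by
  obtain ⟨p, hp, hpz⟩ := hconn.exists_foldl_fstep (foldl_fstep_mem (List.ofFn z.2) hz1) hz1'
  refine ⟨p ++ List.ofFn z'.2, ?_, ?_⟩
  · intro u hu
    rcases List.mem_append.1 hu with hu | hu
    · exact hp u hu
    · obtain ⟨i, rfl⟩ := (List.mem_ofFn' z'.2 u).1 hu
      exact hz2' i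
  · rw [foldl_fhat_eq X k _ (List.ofFn z.2 ++ p) z z'.2 (List.append_assoc _ _ _).symm,
      List.foldl_append, hpz]
end

section
/- Let (X, U, f) be a robot grid search problem, x_I ∈ X, and let (u_n)_{n≥1} be a rich sequence over U. Define the trajectory x_1 = x_I, x_{n+1} = f(x_n, u_n). Then for every state x ∈ X and every finite action sequence (w_1, …, w_k) ∈ U^k, there are infinitely many n ∈ ℕ with x_n = x and (u_n, u_{n+1}, …, u_{n+k−1}) = (w_1, …, w_k). -/
theorem fstep_mem_s2 (X : Set (ℤ × ℤ)) {s : ℤ × ℤ} (hs : s ∈ X) (a : ℤ × ℤ) :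
    fstep X s a ∈ X := by
  unfold fstep
  split_ifs with h
  · exact h
  · exact hs

theorem foldl_fstep_mem_s2 (X : Set (ℤ × ℤ)) (v : List (ℤ × ℤ)) {s : ℤ × ℤ} (hs : s ∈ X) :
    v.foldl (fstep X) s ∈ X := by
  induction v generalizing s with
  | nil => exact hs
  | cons a v ih => exact ih (fstep_mem_s2 X hs a)

/-- The word `a ++ b` occurs in `u` at position `n` iff `a` occurs there and `b` occurs
right after it. -/
theorem ofFn_eq_append_iff {α : Type*} (u : ℕ → α) (n : ℕ) (a b : List α) :
    (List.ofFn fun i : Fin (a ++ b).length => u (n + i)) = a ++ b ↔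
      (List.ofFn fun i : Fin a.length => u (n + i)) = a ∧
        (List.ofFn fun i : Fin b.length => u (n + a.length + i)) = b := by
  have h : (List.ofFn fun i : Fin (a ++ b).length => u (n + i)) =
      (List.ofFn fun i : Fin a.length => u (n + i)) ++
        List.ofFn fun i : Fin b.length => u (n + a.length + i) := by
    rw [List.ofFn_congr List.length_append, List.ofFn_add]
    simp [add_assoc]
  rw [h]
  exact ⟨fun h => List.append_inj h (by simp), fun h => by rw [h.1, h.2]⟩

/-- If the word `v` occurs in `u` at position `n`, the trajectory executes `v` from `x n`. -/
theorem trajectory_eq_foldl (X : Set (ℤ × ℤ)) {u x : ℕ → ℤ × ℤ}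
    (hxs : ∀ n, x (n + 1) = fstep X (x n) (u n)) (v : List (ℤ × ℤ)) (n : ℕ)
    (hv : (List.ofFn fun i : Fin v.length => u (n + i)) = v) :
    x (n + v.length) = v.foldl (fstep X) (x n) := by
  induction v generalizing n with
  | nil => rfl
  | cons a v ih =>
    obtain ⟨ha, hv⟩ := (ofFn_eq_append_iff u n [a] v).1 hv
    have ha : u n = a := by simpa using ha
    rw [List.foldl_cons, ← ha, ← hxs, ← ih (n + 1) hv, List.length_cons]
    congr 1
    omega

theorem sub_mem_Ugrid_s2 {p q : ℤ × ℤ} (h : (q.1 - p.1).natAbs + (q.2 - p.2).natAbs = 1) :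
    q - p ∈ Ugrid := by
  simp only [Ugrid, Set.mem_insert_iff, Set.mem_singleton_iff, Prod.ext_iff, Prod.fst_sub,
    Prod.snd_sub]
  omega

/-- In a connected grid every state can be steered to every other state. -/
theorem ConnectedGrid.exists_word {X : Set (ℤ × ℤ)} (hconn : ConnectedGrid X) {s y : ℤ × ℤ}
    (hs : s ∈ X) (hy : y ∈ X) :
    ∃ v : List (ℤ × ℤ), (∀ a ∈ v, a ∈ Ugrid) ∧ v.foldl (fstep X) s = y := by
  obtain ⟨n, z, hz, rfl, rfl, hstep⟩ := hconn s hs y hy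
  suffices ∀ k : Fin (n + 1), ∃ v : List (ℤ × ℤ), (∀ a ∈ v, a ∈ Ugrid) ∧
      v.foldl (fstep X) (z 0) = z k from this _
  intro k
  induction k using Fin.induction with
  | zero => exact ⟨[], by simp, rfl⟩
  | succ k ih =>
    obtain ⟨v, hv, hvk⟩ := ih
    refine ⟨v ++ [z k.succ - z k.castSucc], ?_, ?_⟩
    · intro a ha
      rcases List.mem_append.1 ha with h | h
      · exact hv a h
      · rw [List.mem_singleton.1 h]
        exact sub_mem_Ugrid_s2 (hstep k)
    · simp [hvk, fstep, hz]

/-- There is a single word whose execution from any state of a given finite set visits `y`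
with `w` as the next actions. -/
theorem exists_word_visiting_s2 (X : Set (ℤ × ℤ)) (hconn : ConnectedGrid X) {y : ℤ × ℤ}
    (hy : y ∈ X) {w : List (ℤ × ℤ)} (hw : ∀ a ∈ w, a ∈ Ugrid) (S : Finset (ℤ × ℤ))
    (hS : ∀ s ∈ S, s ∈ X) :
    ∃ v : List (ℤ × ℤ), (∀ a ∈ v, a ∈ Ugrid) ∧
      ∀ s ∈ S, ∃ p q, v = p ++ w ++ q ∧ p.foldl (fstep X) s = y := by
  induction S using Finset.induction_on with
  | empty => exact ⟨[], by simp, by simp⟩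
  | insert s S _ ih =>
    obtain ⟨v, hv, hvisit⟩ := ih fun t ht => hS t (Finset.mem_insert_of_mem ht)
    obtain ⟨r, hr, hry⟩ := hconn.exists_word
      (foldl_fstep_mem_s2 X v (hS s (Finset.mem_insert_self s S))) hy
    refine ⟨v ++ r ++ w, ?_, fun t ht => ?_⟩
    · intro a ha
      simp only [List.mem_append] at ha
      rcases ha with (h | h) | h
      exacts [hv a h, hr a h, hw a h]
    · rcases Finset.mem_insert.1 ht with rfl | ht
      · exact ⟨v ++ r, [], by simp, by rw [List.foldl_append, hry]⟩
      · obtain ⟨p, q, rfl, hp⟩ := hvisit t ht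
        exact ⟨p, q ++ r ++ w, by simp, hp⟩

/-- **A rich plan tries every action sequence from every state.**  If `u` is a rich
sequence over the alphabet `Ugrid` (every finite word over `Ugrid` occurs contiguously),
then for every state `y ∈ X` and every finite action sequence `w`, the trajectory is at
`y` while about to execute exactly `w` at infinitely many stages. -/
theorem stmt2 (X : Set (ℤ × ℤ)) (hfin : X.Finite) (hne : X.Nonempty)
    (hconn : ConnectedGrid X) (xI : ℤ × ℤ) (hxI : xI ∈ X)
    (u : ℕ → ℤ × ℤ) (hu : ∀ n, u n ∈ Ugrid)
    (hrich : ∀ w : List (ℤ × ℤ), (∀ a ∈ w, a ∈ Ugrid) →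
      ∃ n : ℕ, (List.ofFn fun i : Fin w.length => u (n + i)) = w)
    (x : ℕ → ℤ × ℤ) (hx0 : x 0 = xI) (hxs : ∀ n, x (n + 1) = fstep X (x n) (u n)) :
    ∀ y ∈ X, ∀ w : List (ℤ × ℤ), (∀ a ∈ w, a ∈ Ugrid) →
      {n : ℕ | x n = y ∧ (List.ofFn fun i : Fin w.length => u (n + i)) = w}.Infinite := by
  intro y hy w hw
  obtain ⟨v, hv, hvisit⟩ := exists_word_visiting_s2 X hconn hy hw hfin.toFinset (by simp)
  refine Set.infinite_of_forall_exists_gt fun M => ?_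
  obtain ⟨n, hn⟩ := hrich (List.replicate (M + 1) (1, 0) ++ v) (by
    intro a ha
    rcases List.mem_append.1 ha with h | h
    · rw [List.eq_of_mem_replicate h]
      simp [Ugrid]
    · exact hv a h)
  have hmem : ∀ k, x k ∈ X := by
    intro k
    induction k with
    | zero => rwa [hx0]
    | succ k ih => rw [hxs]; exact fstep_mem_s2 X ih (u k)
  have hvn := ((ofFn_eq_append_iff u n _ v).1 hn).2
  rw [List.length_replicate] at hvn
  obtain ⟨p, q, rfl, hp⟩ := hvisit (x (n + (M + 1))) (by simpa using hmem (n + (M + 1)))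
  rw [List.append_assoc, ofFn_eq_append_iff, ofFn_eq_append_iff] at hvn
  exact ⟨n + (M + 1) + p.length, ⟨(trajectory_eq_foldl X hxs p _ hvn.1).trans hp, hvn.2.1⟩, by omega⟩
end

section
/- Let X ⊂ ℝ² be compact and connected with nonempty interior, let x_G ∈ int X, r > 0, and m ∈ ℕ. Then the collection of pairs {(X_grid(x_I, m) − x_I, x_G(x_I, m) − x_I) : x_I ∈ int X} is finite; in particular, the family of discretized planning problems (X_grid(x_I, m), x_I, x_G(x_I, m)) for x_I ∈ int X contains only finitely many problems up to the equivalence given by translating the grid, the initial state, and the goal set by a common vector. -/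
/-- Shorthand for the Euclidean plane `ℝ²`. -/
noncomputable abbrev E2 : Type := EuclideanSpace ℝ (Fin 2)

/-- Embedding of the integer lattice `ℤ×ℤ` into `ℝ²`. -/
noncomputable def emb (p : ℤ × ℤ) : E2 :=
  (WithLp.equiv 2 (Fin 2 → ℝ)).symm ![(p.1 : ℝ), (p.2 : ℝ)]

/-- The grid `X_grid(x_I, m) := int X ∩ (x_I + 2^{−m}(ℤ×ℤ))`. -/
def grid (X : Set E2) (xI : E2) (m : ℕ) : Set E2 :=
  interior X ∩ {y | ∃ p : ℤ × ℤ, y = xI + ((2 : ℝ) ^ (-(m : ℤ))) • emb p}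

/-- The discretized goal set `x_G(x_I, m) := B_r(x_G) ∩ (x_I + 2^{−m}(ℤ×ℤ))`. -/
def goalSet (xG : E2) (r : ℝ) (xI : E2) (m : ℕ) : Set E2 :=
  Metric.ball xG r ∩ {y | ∃ p : ℤ × ℤ, y = xI + ((2 : ℝ) ^ (-(m : ℤ))) • emb p}

theorem abs_fst_le_norm_emb (p : ℤ × ℤ) : |(p.1 : ℝ)| ≤ ‖emb p‖ := by
  simpa [emb] using PiLp.norm_apply_le (emb p) 0

theorem abs_snd_le_norm_emb (p : ℤ × ℤ) : |(p.2 : ℝ)| ≤ ‖emb p‖ := by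
  simpa [emb] using PiLp.norm_apply_le (emb p) 1

theorem finite_setOf_norm_emb_le (D : ℝ) : {p : ℤ × ℤ | ‖emb p‖ ≤ D}.Finite := by
  refine ((Set.finite_Icc (-⌈D⌉) ⌈D⌉).prod (Set.finite_Icc (-⌈D⌉) ⌈D⌉)).subset ?_
  intro p hp
  have key : ∀ n : ℤ, |(n : ℝ)| ≤ D → n ∈ Set.Icc (-⌈D⌉) ⌈D⌉ := fun n hn => by
    have h : |n| ≤ ⌈D⌉ := by exact_mod_cast hn.trans (Int.le_ceil D)
    exact abs_le.mp h
  exact ⟨key _ ((abs_fst_le_norm_emb p).trans hp), key _ ((abs_snd_le_norm_emb p).trans hp)⟩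

/-- A bounded part of a scaled lattice is finite. -/
theorem finite_lattice_inter_closedBall {c : ℝ} (hc : 0 < c) (D : ℝ) :
    {v : E2 | ‖v‖ ≤ D ∧ ∃ p : ℤ × ℤ, v = c • emb p}.Finite := by
  refine ((finite_setOf_norm_emb_le (D / c)).image fun p => c • emb p).subset ?_
  rintro _ ⟨hv, p, rfl⟩
  refine ⟨p, ?_, rfl⟩
  rw [norm_smul, Real.norm_of_nonneg hc.le] at hv
  exact (le_div_iff₀' hc).mpr hv

/-- Lattice points based at `x` lying in a bounded set, translated by `-x`, stay in a fixed
bounded part of the lattice. -/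
theorem image_sub_inter_lattice_subset {S : Set E2} {R c : ℝ} {x : E2}
    (hS : ∀ y ∈ S, ‖y‖ ≤ R) (hx : ‖x‖ ≤ R) :
    (fun y => y - x) '' (S ∩ {y | ∃ p : ℤ × ℤ, y = x + c • emb p}) ⊆
      {v : E2 | ‖v‖ ≤ R + R ∧ ∃ p : ℤ × ℤ, v = c • emb p} := by
  rintro _ ⟨y, ⟨hy, p, hp⟩, rfl⟩
  exact ⟨(norm_sub_le y x).trans (add_le_add (hS y hy) hx), p, by simp [hp]⟩

/-- **Finitely many non-isomorphic discretized planning problems.**  As `x_I`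
ranges over the interior of `X`, the pairs (grid, discretized goal set), translated
by the common vector `−x_I`, form a finite collection; hence the discretized planning
problems `(X_grid(x_I,m), x_I, x_G(x_I,m))` contain only finitely many problems up to
translation of grid, initial state and goal set by a common vector. -/
theorem stmt7 (X : Set E2) (hcomp : IsCompact X) (hconn : IsConnected X)
    (hint : (interior X).Nonempty) (xG : E2) (hxG : xG ∈ interior X)
    (r : ℝ) (hr : 0 < r) (m : ℕ) :
    {AB : Set E2 × Set E2 | ∃ xI ∈ interior X,
      AB.1 = (fun y => y - xI) '' grid X xI m ∧
      AB.2 = (fun y => y - xI) '' goalSet xG r xI m}.Finite := by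
  obtain ⟨R, hR⟩ := (hcomp.isBounded.union (Metric.isBounded_ball (x := xG) (r := r))).exists_norm_le
  have hX : ∀ y ∈ interior X, ‖y‖ ≤ R := fun y hy => hR y (Or.inl (interior_subset hy))
  have hB : ∀ y ∈ Metric.ball xG r, ‖y‖ ≤ R := fun y hy => hR y (Or.inr hy)
  have hF := (finite_lattice_inter_closedBall
    (zpow_pos (two_pos : (0 : ℝ) < 2) (-(m : ℤ))) (R + R)).finite_subsets
  refine (hF.prod hF).subset ?_
  rintro ⟨A, B⟩ ⟨xI, hxI, rfl, rfl⟩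
  exact ⟨image_sub_inter_lattice_subset hX (hX xI hxI),
    image_sub_inter_lattice_subset hB (hX xI hxI)⟩
end

section
/- Fix w > 0 and m ∈ ℕ. Let ω_n := 1 if (φ∘η_w)(n) = m and ω_n := 0 otherwise, i.e., ω is the indicator sequence of the set of stages at which the scale-free plan uses step size 2^{−m}. Then the binary sequence (ω_n)_{n≥1} is completely deterministic. -/
/-- `β_n := max {k : k(k+1)/2 ≤ n}`. -/
noncomputable def betaSeq (n : ℕ) : ℕ := sSup {k : ℕ | k * (k + 1) / 2 ≤ n}

/-- `φ(n) := n − β_n(β_n+1)/2`. -/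
noncomputable def phiSeq (n : ℕ) : ℕ := n - betaSeq n * (betaSeq n + 1) / 2

/-- `η_w(n) := max {k : Σ_{j=1}^k L_w(j) ≤ n}` (for the step-length sequence `L`). -/
noncomputable def etaSeq (L : ℕ → ℕ) (n : ℕ) : ℕ :=
  sSup {k : ℕ | (∑ j ∈ Finset.Icc 1 k, L j) ≤ n}

open Classical in
/-- A binary sequence `ω` is completely deterministic: for every `ε > 0` there is a
block length `K` such that, after removing a set `R` of indices of upper asymptotic
density `< ε`, the remaining indices are covered by occurrences of words of length `K`
from a collection `C` with `|C| < 2^{εK}`. -/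
def CompletelyDeterministic (ω : ℕ → Bool) : Prop :=
  ∀ ε : ℝ, 0 < ε → ∃ K : ℕ, ∃ R : Set ℕ, ∃ C : Finset (Fin K → Bool),
    Filter.limsup
      (fun N : ℕ => (((Finset.range N).filter (fun n => n ∈ R)).card : ℝ) / N)
      Filter.atTop < ε ∧
    (C.card : ℝ) < 2 ^ (ε * K) ∧
    ∀ i : ℕ, i ∉ R → ∃ n : ℕ, n ≤ i ∧ i < n + K ∧ (fun j : Fin K => ω (n + (j : ℕ))) ∈ C

open Filter Asymptotics

/-- Telescoping of the increments of step `K`. -/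
theorem sum_range_shift_sub (f : ℕ → ℝ) (K N : ℕ) :
    ∑ i ∈ Finset.range N, (f (i + K) - f i) = ∑ j ∈ Finset.range K, (f (N + j) - f j) := by
  have h₁ := Finset.sum_range_add f N K
  have h₂ := Finset.sum_range_add f K N
  rw [add_comm K N] at h₂
  simp only [Finset.sum_sub_distrib, add_comm _ K]
  linarith

/-- A sublinear sequence stays sublinear after a shift of the argument. -/
theorem isLittleO_natCast_shift {f : ℕ → ℝ} (hf : f =o[atTop] fun n : ℕ => (n : ℝ)) (c : ℕ) :
    (fun n => f (n + c)) =o[atTop] fun n : ℕ => (n : ℝ) := by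
  refine (hf.comp_tendsto (tendsto_add_atTop_nat c)).trans_isBigO ?_
  refine IsBigO.of_bound (1 + c) ?_
  filter_upwards [eventually_ge_atTop 1] with n hn
  have hn' : (1 : ℝ) ≤ n := by exact_mod_cast hn
  have hc : (0 : ℝ) ≤ c := c.cast_nonneg
  simp only [Function.comp_apply, Nat.cast_add, Real.norm_eq_abs]
  rw [abs_of_nonneg (by positivity), abs_of_nonneg (by positivity)]
  nlinarith

open Classical in
/-- The windows of length `K` on which a monotone sequence `f` is not constant number at most
`K * f (N + K)` among the first `N`. -/
theorem card_filter_ne_shift_le {f : ℕ → ℕ} (hf : Monotone f) (K N : ℕ) :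
    (((Finset.range N).filter (fun n => f n ≠ f (n + K))).card : ℝ) ≤ K * f (N + K) := by
  calc (((Finset.range N).filter (fun n => f n ≠ f (n + K))).card : ℝ)
      = ∑ i ∈ Finset.range N, if f i ≠ f (i + K) then (1 : ℝ) else 0 := by
        rw [Finset.sum_boole]
    _ ≤ ∑ i ∈ Finset.range N, ((f (i + K) : ℝ) - f i) := by
        refine Finset.sum_le_sum fun i _ => ?_
        have hle : f i ≤ f (i + K) := hf (Nat.le_add_right i K)
        split_ifs with h
        · have : f i + 1 ≤ f (i + K) := by omega
          have : (f i : ℝ) + 1 ≤ f (i + K) := by exact_mod_cast this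
          linarith
        · exact sub_nonneg.2 (by exact_mod_cast hle)
    _ = ∑ j ∈ Finset.range K, ((f (N + j) : ℝ) - f j) :=
        sum_range_shift_sub (fun n => (f n : ℝ)) K N
    _ ≤ ∑ _j ∈ Finset.range K, (f (N + K) : ℝ) := by
        refine Finset.sum_le_sum fun j hj => ?_
        have hle : f (N + j) ≤ f (N + K) := hf (by have := Finset.mem_range.1 hj; omega)
        have : (f (N + j) : ℝ) ≤ f (N + K) := by exact_mod_cast hle
        linarith [(f j).cast_nonneg (α := ℝ)]
    _ = K * f (N + K) := by simp

/-- A binary sequence that factors through a monotone sublinear sequence is completely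
deterministic: almost all of its windows are constant. -/
theorem completelyDeterministic_comp_of_isLittleO {f : ℕ → ℕ} (hf : Monotone f)
    (ho : (fun n => (f n : ℝ)) =o[atTop] fun n : ℕ => (n : ℝ)) (g : ℕ → Bool) :
    CompletelyDeterministic (fun n => g (f n)) := by
  classical
  intro ε hε
  obtain ⟨K, hK⟩ := exists_nat_gt (1 / ε)
  have hKpos : 0 < K := by
    have : (0 : ℝ) < K := (by positivity : (0 : ℝ) < 1 / ε).trans hK
    exact_mod_cast this
  have hεK : 1 < ε * K := by rwa [div_lt_iff₀' hε] at hK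
  refine ⟨K, {n | f n ≠ f (n + K)}, Finset.univ.image fun b : Bool => fun _ => b, ?_, ?_, ?_⟩
  · refine lt_of_eq_of_lt (Tendsto.limsup_eq ?_) hε
    have hlim := ((isLittleO_natCast_shift ho K).const_mul_left (K : ℝ)).tendsto_div_nhds_zero
    refine squeeze_zero (fun N => by positivity) (fun N => ?_) hlim
    refine div_le_div_of_nonneg_right ?_ N.cast_nonneg
    simpa only [Set.mem_ofPred_eq] using card_filter_ne_shift_le hf K N
  · calc (((Finset.univ.image fun b : Bool => fun _ : Fin K => b).card : ℕ) : ℝ)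
        ≤ (Finset.univ : Finset Bool).card := by exact_mod_cast Finset.card_image_le
      _ = 2 ^ (1 : ℝ) := by simp
      _ < 2 ^ (ε * K) := Real.rpow_lt_rpow_of_exponent_lt one_lt_two hεK
  · intro i hi
    have hi : f i = f (i + K) := by simpa using hi
    refine ⟨i, le_rfl, by omega, Finset.mem_image.2 ⟨g (f i), Finset.mem_univ _, ?_⟩⟩
    funext j
    have h₁ : f i ≤ f (i + j) := hf (by omega)
    have h₂ : f (i + j) ≤ f (i + K) := hf (by omega)
    exact congrArg g (by omega)

/-- The partial sums of the step lengths grow geometrically. -/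
theorem pow_le_sum_stepLength {w : ℝ} (hw : 0 < w) {L : ℕ → ℕ} (hL1 : L 1 = 1)
    (hLrec : ∀ n, 2 ≤ n → L n = ⌈w * ∑ j ∈ Finset.Icc 1 (n - 1), (L j : ℝ)⌉₊) (k : ℕ) :
    (1 + w) ^ k ≤ ((∑ j ∈ Finset.Icc 1 (k + 1), L j : ℕ) : ℝ) := by
  induction k with
  | zero => simp [hL1]
  | succ k ih =>
    rw [Finset.sum_Icc_succ_top (by omega), Nat.cast_add, hLrec (k + 1 + 1) (by omega),
      Nat.add_sub_cancel, pow_succ]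
    have h := Nat.le_ceil (w * ∑ j ∈ Finset.Icc 1 (k + 1), (L j : ℝ))
    push_cast at ih h ⊢
    nlinarith

section Growth

variable {w : ℝ} {L : ℕ → ℕ}

theorem bddAbove_etaSeq_set (hw : 0 < w)
    (hL : ∀ k, (1 + w) ^ k ≤ ((∑ j ∈ Finset.Icc 1 (k + 1), L j : ℕ) : ℝ)) (n : ℕ) :
    BddAbove {k : ℕ | (∑ j ∈ Finset.Icc 1 k, L j) ≤ n} := by
  refine ⟨⌈n / w⌉₊ + 1, fun k hk => ?_⟩
  obtain _ | k := k
  · omega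
  have hk : ((∑ j ∈ Finset.Icc 1 (k + 1), L j : ℕ) : ℝ) ≤ n := by exact_mod_cast hk
  have hb := one_add_mul_le_pow (by linarith : -2 ≤ w) k
  have : (k : ℝ) ≤ n / w := by
    rw [le_div_iff₀ hw]
    linarith [hL k]
  have : k ≤ ⌈n / w⌉₊ := by exact_mod_cast this.trans (Nat.le_ceil _)
  omega

theorem monotone_etaSeq (hw : 0 < w)
    (hL : ∀ k, (1 + w) ^ k ≤ ((∑ j ∈ Finset.Icc 1 (k + 1), L j : ℕ) : ℝ)) :
    Monotone (etaSeq L) := fun _ n hab =>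
  csSup_le_csSup (bddAbove_etaSeq_set hw hL n) ⟨0, by simp⟩ fun _ hk => le_trans hk hab

theorem etaSeq_le_log (hw : 0 < w)
    (hL : ∀ k, (1 + w) ^ k ≤ ((∑ j ∈ Finset.Icc 1 (k + 1), L j : ℕ) : ℝ)) (n : ℕ) :
    (etaSeq L n : ℝ) ≤ (Real.log (1 + w))⁻¹ * Real.log n + 1 := by
  have hlog : 0 < Real.log (1 + w) := Real.log_pos (by linarith)
  have hmem : (∑ j ∈ Finset.Icc 1 (etaSeq L n), L j) ≤ n :=
    Nat.sSup_mem ⟨0, by simp⟩ (bddAbove_etaSeq_set hw hL n)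
  obtain h | ⟨k, h⟩ := (Nat.eq_zero_or_pos (etaSeq L n)).imp_right
    fun h => Nat.exists_eq_succ_of_ne_zero h.ne'
  · rw [h, Nat.cast_zero]
    have := Real.log_natCast_nonneg n
    positivity
  · rw [h] at hmem ⊢
    have hpow : (1 + w) ^ k ≤ (n : ℝ) := (hL k).trans (by exact_mod_cast hmem)
    have hle := Real.log_le_log (by positivity) hpow
    rw [Real.log_pow] at hle
    rw [Nat.cast_succ, inv_mul_eq_div]
    gcongr
    rwa [le_div_iff₀ hlog]

theorem etaSeq_isLittleO (hw : 0 < w)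
    (hL : ∀ k, (1 + w) ^ k ≤ ((∑ j ∈ Finset.Icc 1 (k + 1), L j : ℕ) : ℝ)) :
    (fun n => (etaSeq L n : ℝ)) =o[atTop] fun n : ℕ => (n : ℝ) := by
  have hbound : (fun x : ℝ => (Real.log (1 + w))⁻¹ * Real.log x + 1) =o[atTop] id :=
    (Real.isLittleO_log_id_atTop.const_mul_left _).add (isLittleO_const_id_atTop 1)
  refine IsBigO.trans_isLittleO (IsBigO.of_bound 1 (.of_forall fun n => ?_))
    (hbound.comp_tendsto tendsto_natCast_atTop_atTop)
  rw [one_mul, Real.norm_of_nonneg (Nat.cast_nonneg _)]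
  exact (etaSeq_le_log hw hL n).trans (le_abs_self _)

end Growth

/-- **Step size subsequences are completely deterministic.**  Fix `w > 0` and `m ∈ ℕ`,
and let `L` satisfy `L(1) = 1`, `L(n) = ⌈w(L(1)+⋯+L(n−1))⌉` for `n ≥ 2`.  The indicator
sequence of the set of stages `n` (counted from 1) at which `(φ ∘ η_w)(n) = m`, i.e. at
which the scale-free plan uses step size `2^{−m}`, is completely deterministic. -/
theorem stmt9 (w : ℝ) (hw : 0 < w) (m : ℕ) (L : ℕ → ℕ) (hL1 : L 1 = 1)
    (hLrec : ∀ n, 2 ≤ n → L n = ⌈w * ∑ j ∈ Finset.Icc 1 (n - 1), (L j : ℝ)⌉₊) :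
    CompletelyDeterministic (fun n => decide (phiSeq (etaSeq L (n + 1)) = m)) := by
  have hL := pow_le_sum_stepLength hw hL1 hLrec
  exact completelyDeterministic_comp_of_isLittleO (f := fun n => etaSeq L (n + 1))
    (fun _ _ hab => monotone_etaSeq hw hL (Nat.succ_le_succ hab))
    (isLittleO_natCast_shift (etaSeq_isLittleO hw hL) 1) fun k => decide (phiSeq k = m)
end

section
/- Let (X, U, f) be a robot grid search problem, x_I ∈ X, and let X_G ⊆ X be a nonempty goal set. Let L be the minimal length of a finite action sequence ũ with x_I⌢ũ ∈ X_G. If (u_n)_{n≥1} is a rich sequence over U and the trajectory is x_1 = x_I, x_{n+1} = f(x_n, u_n), then there exists n ∈ ℕ with x_n = x_I and x_{n+L} ∈ X_G; that is, the trajectory eventually executes a shortest successful plan starting from a visit to the initial state. -/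
theorem foldl_mem {α β : Type*} {f : α → β → α} {A : Set α} {U : Set β}
    (hA : ∀ x ∈ A, ∀ u ∈ U, f x u ∈ A) (w : List β) (hw : ∀ u ∈ w, u ∈ U) {x : α} (hx : x ∈ A) :
    w.foldl f x ∈ A := by
  induction w generalizing x with
  | nil => exact hx
  | cons a w ih =>
    simp only [List.mem_cons, forall_eq_or_imp] at hw
    exact ih hw.2 (hA x hx a hw.1)

/-- If `t` is reachable from every state of `A`, then a single word drives every state of a
finite subset of `A` through `t`, followed immediately by the prescribed word `v`. -/
theorem exists_word_through {α β : Type*} {f : α → β → α} {A : Set α} {U : Set β}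
    (hA : ∀ x ∈ A, ∀ u ∈ U, f x u ∈ A) {t : α}
    (hreach : ∀ x ∈ A, ∃ p : List β, (∀ u ∈ p, u ∈ U) ∧ p.foldl f x = t)
    (v : List β) (hv : ∀ u ∈ v, u ∈ U) {S : Set α} (hS : S.Finite) (hSA : S ⊆ A) :
    ∃ w : List β, (∀ u ∈ w, u ∈ U) ∧
      ∀ s ∈ S, ∃ p q : List β, w = p ++ v ++ q ∧ p.foldl f s = t := by
  induction S, hS using Set.Finite.induction_on with
  | empty => exact ⟨[], by simp, by simp⟩
  | @insert a S _ _ ih =>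
    obtain ⟨w, hw, hwS⟩ := ih ((Set.subset_insert a S).trans hSA)
    obtain ⟨p, hp, hpt⟩ := hreach _ (foldl_mem hA w hw (hSA (Set.mem_insert a S)))
    refine ⟨w ++ p ++ v, ?_, ?_⟩
    · simp only [List.mem_append]
      rintro u ((h | h) | h)
      exacts [hw u h, hp u h, hv u h]
    · rintro s (rfl | hs)
      · exact ⟨w ++ p, [], by simp, by simpa using hpt⟩
      · obtain ⟨p', q', hpq, ht⟩ := hwS s hs
        exact ⟨p', q' ++ p ++ v, by simp [hpq], ht⟩

theorem trajectory_add_length {α β : Type*} {f : α → β → α} {u : ℕ → β} {x : ℕ → α}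
    (hx : ∀ n, x (n + 1) = f (x n) (u n)) (w : List β) (n : ℕ)
    (hw : ∀ (i : ℕ) (h : i < w.length), u (n + i) = w[i]) :
    x (n + w.length) = w.foldl f (x n) := by
  induction w generalizing n with
  | nil => rfl
  | cons a w ih =>
    have h0 : u n = a := hw 0 (by simp)
    have h1 := ih (n + 1) fun i h => by
      rw [Nat.add_right_comm, Nat.add_assoc, hw (i + 1) (Nat.succ_lt_succ h),
        List.getElem_cons_succ]
    rw [List.foldl_cons, ← h0, ← hx, ← h1, List.length_cons, Nat.add_comm w.length 1,
      ← Nat.add_assoc]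

theorem sub_mem_Ugrid_s14 {a b : ℤ × ℤ} (h : (b.1 - a.1).natAbs + (b.2 - a.2).natAbs = 1) :
    b - a ∈ Ugrid := by
  simp only [Ugrid, Set.mem_insert_iff, Set.mem_singleton_iff, Prod.ext_iff, Prod.fst_sub,
    Prod.snd_sub]
  omega

theorem ConnectedGrid.exists_foldl_eq {X : Set (ℤ × ℤ)} (hX : ConnectedGrid X) {a b : ℤ × ℤ}
    (ha : a ∈ X) (hb : b ∈ X) :
    ∃ p : List (ℤ × ℤ), (∀ u ∈ p, u ∈ Ugrid) ∧ p.foldl (fstep X) a = b := by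
  obtain ⟨n, x, hx, rfl, rfl, hstep⟩ := hX a ha b hb
  suffices h : ∀ k : Fin (n + 1), ∃ p : List (ℤ × ℤ), (∀ u ∈ p, u ∈ Ugrid) ∧
      p.foldl (fstep X) (x 0) = x k from h _
  intro k
  induction k using Fin.induction with
  | zero => exact ⟨[], by simp, rfl⟩
  | succ k ih =>
    obtain ⟨p, hp, hpk⟩ := ih
    refine ⟨p ++ [x k.succ - x k.castSucc], ?_, ?_⟩
    · simp only [List.mem_append, List.mem_singleton]
      rintro u (h | rfl)
      exacts [hp u h, sub_mem_Ugrid_s14 (hstep k)]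
    · simp [hpk, fstep, hx]

/-- **A rich plan eventually executes a shortest successful plan from the initial state.**
If `L` is the minimal length of an action sequence taking `x_I` into the goal set `X_G`,
and the robot follows a rich action sequence, then at some stage `n` the trajectory is at
`x_I` and `L` steps later it is in `X_G`. -/
theorem stmt14 (X : Set (ℤ × ℤ)) (hfin : X.Finite) (hne : X.Nonempty)
    (hconn : ConnectedGrid X) (xI : ℤ × ℤ) (hxI : xI ∈ X)
    (XG : Set (ℤ × ℤ)) (hXG : XG ⊆ X) (hXGne : XG.Nonempty)
    (L : ℕ)
    (hLach : ∃ us : List (ℤ × ℤ), (∀ u ∈ us, u ∈ Ugrid) ∧ us.length = L ∧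
      us.foldl (fstep X) xI ∈ XG)
    (hLmin : ∀ us : List (ℤ × ℤ), (∀ u ∈ us, u ∈ Ugrid) →
      us.foldl (fstep X) xI ∈ XG → L ≤ us.length)
    (u : ℕ → ℤ × ℤ) (hu : ∀ n, u n ∈ Ugrid)
    (hrich : ∀ w : List (ℤ × ℤ), (∀ a ∈ w, a ∈ Ugrid) →
      ∃ n : ℕ, (List.ofFn fun i : Fin w.length => u (n + i)) = w)
    (x : ℕ → ℤ × ℤ) (hx0 : x 0 = xI) (hxs : ∀ n, x (n + 1) = fstep X (x n) (u n)) :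
    ∃ n : ℕ, x n = xI ∧ x (n + L) ∈ XG := by
  obtain ⟨v, hv, rfl, hvG⟩ := hLach
  obtain ⟨w, hw, hwX⟩ := exists_word_through (fun y hy a _ => fstep_mem hy a)
    (fun y hy => hconn.exists_foldl_eq hy hxI) v hv hfin subset_rfl
  have hxX : ∀ n, x n ∈ X := by
    intro n
    induction n with
    | zero => exact hx0 ▸ hxI
    | succ n ih => exact hxs n ▸ fstep_mem ih _
  obtain ⟨n, hn⟩ := hrich w hw
  have hget : ∀ (i : ℕ) (h : i < w.length), u (n + i) = w[i] := fun i h => by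
    rw [List.getElem_of_eq hn.symm h, List.getElem_ofFn]
  obtain ⟨p, q, rfl, hp⟩ := hwX (x n) (hxX n)
  have hxp : x (n + p.length) = xI := by
    rw [trajectory_add_length hxs p n, hp]
    intro i h
    rw [hget i (by simp only [List.length_append]; omega)]
    simp [h]
  refine ⟨n + p.length, hxp, ?_⟩
  rw [trajectory_add_length hxs v, hxp]
  · exact hvG
  · intro i h
    rw [Nat.add_assoc, hget _ (by simp only [List.length_append]; omega)]
    simp [h]
end

section
/- Let X ⊂ ℝ² be compact and connected with nonempty interior, admitting a globally connected grid representation with sufficient scaling factor η(X); let x_G ∈ int X, r > 0, and m ≥ η(X), and assume that x_G(x_I, m) ∩ int X is nonempty for every x_I ∈ int X. Then there exists a single finite action sequence ũ over the actions {2^{−m}v : v ∈ {(−1,0),(1,0),(0,1),(0,−1)}} such that for every x_I ∈ int X, the trajectory obtained by executing ũ from x_I under the stay-put dynamics on X_grid(x_I, m) (f(x,u) = x+u if x+u ∈ X_grid(x_I, m), and f(x,u) = x otherwise) visits a point of x_G(x_I, m). -/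
/-- A grid is connected (at step size `s`) if any two of its points are joined by a
finite chain of grid points with consecutive points at distance `s`. -/
def GridConnected (G : Set E2) (s : ℝ) : Prop :=
  ∀ a ∈ G, ∀ b ∈ G, ∃ n : ℕ, ∃ c : Fin (n + 1) → E2,
    (∀ k, c k ∈ G) ∧ c 0 = a ∧ c (Fin.last n) = b ∧
    ∀ k : Fin n, dist (c k.succ) (c k.castSucc) = s

/-- The four actions of step size `2^{−m}`. -/
def act (m : ℕ) : Set E2 :=
  {u | ∃ v : ℤ × ℤ, (v = (-1, 0) ∨ v = (1, 0) ∨ v = (0, 1) ∨ v = (0, -1)) ∧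
    u = ((2 : ℝ) ^ (-(m : ℤ))) • emb v}

/-- The stay-put transition function on a set `G ⊆ ℝ²`. -/
noncomputable def fgrid (G : Set E2) (x u : E2) : E2 :=
  @ite _ (x + u ∈ G) (Classical.propDecidable _) (x + u) x

/-- The integer offsets of the four actions. -/
def unitSteps : Set (ℤ × ℤ) :=
  {v | v = (-1, 0) ∨ v = (1, 0) ∨ v = (0, 1) ∨ v = (0, -1)}

/-- The stay-put dynamics in integer coordinates. -/
noncomputable def stayPut (S : Set (ℤ × ℤ)) (p v : ℤ × ℤ) : ℤ × ℤ :=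
  @ite _ (p + v ∈ S) (Classical.propDecidable _) (p + v) p

/-- The integer coordinates, relative to `x` at step size `s`, of the lattice points in `A`. -/
def latticeCoords (A : Set E2) (x : E2) (s : ℝ) : Set (ℤ × ℤ) :=
  {p | x + s • emb p ∈ A}

lemma emb_apply_zero (p : ℤ × ℤ) : emb p 0 = p.1 := rfl

lemma emb_apply_one (p : ℤ × ℤ) : emb p 1 = p.2 := rfl

lemma emb_add (p q : ℤ × ℤ) : emb (p + q) = emb p + emb q := by
  ext i
  fin_cases i <;> simp [emb]

lemma emb_sub (p q : ℤ × ℤ) : emb (p - q) = emb p - emb q := by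
  ext i
  fin_cases i <;> simp [emb]

lemma emb_zero : emb 0 = 0 := by
  ext i
  fin_cases i <;> simp [emb]

lemma emb_injective : Function.Injective emb := by
  intro p q h
  have h0 := congrArg (fun z : E2 => z 0) h
  have h1 := congrArg (fun z : E2 => z 1) h
  simp only [emb_apply_zero, emb_apply_one, Int.cast_inj] at h0 h1
  exact Prod.ext h0 h1

lemma norm_emb_sq (p : ℤ × ℤ) : ‖emb p‖ ^ 2 = (p.1 : ℝ) ^ 2 + (p.2 : ℝ) ^ 2 := by
  rw [EuclideanSpace.norm_sq_eq, Fin.sum_univ_two, emb_apply_zero, emb_apply_one]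
  simp

lemma mem_unitSteps_of_norm_emb {p : ℤ × ℤ} (h : ‖emb p‖ = 1) : p ∈ unitSteps := by
  have h2 := norm_emb_sq p
  rw [h] at h2
  have h3 : p.1 ^ 2 + p.2 ^ 2 = 1 := by
    exact_mod_cast (by linarith : (p.1 : ℝ) ^ 2 + (p.2 : ℝ) ^ 2 = 1)
  obtain ⟨a, b⟩ := p
  simp only at h3
  have ha : a ≤ 1 := by nlinarith [sq_nonneg b]
  have ha' : -1 ≤ a := by nlinarith [sq_nonneg b]
  have hb : b ≤ 1 := by nlinarith [sq_nonneg a]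
  have hb' : -1 ≤ b := by nlinarith [sq_nonneg a]
  simp only [unitSteps, Set.mem_ofPred_eq, Prod.mk.injEq]
  interval_cases a <;> interval_cases b <;> simp_all

lemma mem_box_of_norm_emb_le {p : ℤ × ℤ} {N : ℕ} (h : ‖emb p‖ ≤ N) :
    p ∈ Set.Icc ((-N, -N) : ℤ × ℤ) (N, N) := by
  have h2 := norm_emb_sq p
  have h3 : ‖emb p‖ ^ 2 ≤ (N : ℝ) ^ 2 := by gcongr
  have h4 : p.1 ^ 2 + p.2 ^ 2 ≤ (N : ℤ) ^ 2 := by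
    exact_mod_cast (by linarith : (p.1 : ℝ) ^ 2 + (p.2 : ℝ) ^ 2 ≤ (N : ℝ) ^ 2)
  have h5 := abs_le_of_sq_le_sq' (by nlinarith [sq_nonneg p.2] : p.1 ^ 2 ≤ (N : ℤ) ^ 2) (by simp)
  have h6 := abs_le_of_sq_le_sq' (by nlinarith [sq_nonneg p.1] : p.2 ^ 2 ≤ (N : ℤ) ^ 2) (by simp)
  exact ⟨⟨h5.1, h6.1⟩, ⟨h5.2, h6.2⟩⟩

lemma foldl_stayPut_mem {S : Set (ℤ × ℤ)} {p : ℤ × ℤ} (hp : p ∈ S) (w : List (ℤ × ℤ)) :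
    w.foldl (stayPut S) p ∈ S := by
  induction w generalizing p with
  | nil => exact hp
  | cons v w ih =>
    refine ih ?_
    unfold stayPut
    split_ifs with h
    exacts [h, hp]

lemma mem_grid_iff {X : Set E2} {x : E2} {m : ℕ} (p : ℤ × ℤ) :
    x + (2 : ℝ) ^ (-(m : ℤ)) • emb p ∈ grid X x m ↔
      p ∈ latticeCoords (interior X) x ((2 : ℝ) ^ (-(m : ℤ))) :=
  ⟨fun h => h.1, fun h => ⟨h, p, rfl⟩⟩

lemma foldl_fgrid (X : Set E2) (x : E2) (m : ℕ) (w : List (ℤ × ℤ)) (p : ℤ × ℤ) :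
    (w.map fun v => (2 : ℝ) ^ (-(m : ℤ)) • emb v).foldl (fgrid (grid X x m))
        (x + (2 : ℝ) ^ (-(m : ℤ)) • emb p) =
      x + (2 : ℝ) ^ (-(m : ℤ)) •
        emb (w.foldl (stayPut (latticeCoords (interior X) x ((2 : ℝ) ^ (-(m : ℤ))))) p) := by
  induction w generalizing p with
  | nil => rfl
  | cons v w ih =>
    rw [List.map_cons, List.foldl_cons, List.foldl_cons, ← ih]
    congr 1
    have e : x + (2 : ℝ) ^ (-(m : ℤ)) • emb p + (2 : ℝ) ^ (-(m : ℤ)) • emb v =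
        x + (2 : ℝ) ^ (-(m : ℤ)) • emb (p + v) := by
      rw [emb_add, smul_add, add_assoc]
    unfold fgrid stayPut
    rw [e]
    by_cases hv : p + v ∈ latticeCoords (interior X) x ((2 : ℝ) ^ (-(m : ℤ)))
    · rw [if_pos hv, if_pos ((mem_grid_iff _).2 hv)]
    · rw [if_neg hv, if_neg (mt (mem_grid_iff _).1 hv)]

lemma exists_word_of_gridConnected {X : Set E2} {x : E2} {m : ℕ}
    (h : GridConnected (grid X x m) ((2 : ℝ) ^ (-(m : ℤ)))) {p q : ℤ × ℤ}
    (hp : p ∈ latticeCoords (interior X) x ((2 : ℝ) ^ (-(m : ℤ))))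
    (hq : q ∈ latticeCoords (interior X) x ((2 : ℝ) ^ (-(m : ℤ)))) :
    ∃ w : List (ℤ × ℤ), (∀ v ∈ w, v ∈ unitSteps) ∧
      w.foldl (stayPut (latticeCoords (interior X) x ((2 : ℝ) ^ (-(m : ℤ))))) p = q := by
  have hs : 0 < (2 : ℝ) ^ (-(m : ℤ)) := by positivity
  obtain ⟨n, c, hc, hc0, hcl, hcd⟩ := h _ ((mem_grid_iff p).2 hp) _ ((mem_grid_iff q).2 hq)
  have hc' : ∀ k, ∃ q, c k = x + (2 : ℝ) ^ (-(m : ℤ)) • emb q := fun k => (hc k).2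
  replace hc : ∀ k, c k ∈ interior X := fun k => (hc k).1
  clear h
  generalize (2 : ℝ) ^ (-(m : ℤ)) = s at *
  suffices H : ∀ k : Fin (n + 1), ∀ q, c k = x + s • emb q →
      ∃ w : List (ℤ × ℤ), (∀ v ∈ w, v ∈ unitSteps) ∧
        w.foldl (stayPut (latticeCoords (interior X) x s)) p = q from H _ q hcl
  intro k
  induction k using Fin.induction with
  | zero =>
    intro q hq
    refine ⟨[], by simp, ?_⟩
    rw [hc0] at hq
    exact emb_injective (smul_right_injective E2 hs.ne' (add_left_cancel hq))
  | succ k ih =>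
    intro q hq
    obtain ⟨q', hq'⟩ := hc' k.castSucc
    obtain ⟨w, hw, hwq⟩ := ih q' hq'
    have hstep : q - q' ∈ unitSteps := by
      refine mem_unitSteps_of_norm_emb ?_
      have hd := hcd k
      rw [hq, hq', dist_add_left, dist_eq_norm, ← smul_sub, ← emb_sub, norm_smul,
        Real.norm_of_nonneg hs.le] at hd
      exact mul_left_cancel₀ hs.ne' (hd.trans (mul_one s).symm)
    refine ⟨w ++ [q - q'], ?_, ?_⟩
    · intro v hv
      rcases List.mem_append.1 hv with hv | hv
      · exact hw v hv
      · rwa [List.mem_singleton.1 hv]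
    · have hqS : q ∈ latticeCoords (interior X) x s := by
        have := hc k.succ
        rwa [hq] at this
      rw [List.foldl_append, hwq, List.foldl_cons, List.foldl_nil, stayPut,
        add_sub_cancel, if_pos hqS]

/-- Finitely many connected environments, each with a nonempty reachable goal set, are solved
by a single word of steps. -/
lemma exists_common_word {F : Set (Set (ℤ × ℤ) × Set (ℤ × ℤ))} (hF : F.Finite)
    (h0 : ∀ e ∈ F, (0 : ℤ × ℤ) ∈ e.1)
    (hpath : ∀ e ∈ F, ∀ p ∈ e.1, ∃ w : List (ℤ × ℤ), (∀ v ∈ w, v ∈ unitSteps) ∧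
      w.foldl (stayPut e.1) p ∈ e.2) :
    ∃ w : List (ℤ × ℤ), (∀ v ∈ w, v ∈ unitSteps) ∧
      ∀ e ∈ F, ∃ k ≤ w.length, (w.take k).foldl (stayPut e.1) 0 ∈ e.2 := by
  induction F, hF using Set.Finite.induction_on with
  | empty => exact ⟨[], by simp, by simp⟩
  | @insert a F _ _ ih =>
    obtain ⟨w, hw, hwF⟩ := ih (fun e he => h0 e (Set.mem_insert_of_mem _ he))
      (fun e he => hpath e (Set.mem_insert_of_mem _ he))
    have ha := Set.mem_insert a F
    obtain ⟨w', hw', hgoal⟩ := hpath a ha _ (foldl_stayPut_mem (h0 a ha) w)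
    refine ⟨w ++ w', fun v hv => (List.mem_append.1 hv).elim (hw v) (hw' v), ?_⟩
    rintro e (rfl | he)
    · exact ⟨(w ++ w').length, le_rfl, by rwa [List.take_length, List.foldl_append]⟩
    · obtain ⟨k, hk, hkF⟩ := hwF e he
      refine ⟨k, by simp only [List.length_append]; omega, ?_⟩
      rwa [List.take_append_of_le_length hk]

lemma exists_finite_latticeCoords_subset {A : Set E2} (hA : Bornology.IsBounded A) {s : ℝ}
    (hs : 0 < s) :
    ∃ B : Set (ℤ × ℤ), B.Finite ∧ ∀ x ∈ A, latticeCoords A x s ⊆ B := by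
  obtain ⟨R, hR⟩ := hA.exists_norm_le
  obtain ⟨N, hN⟩ := exists_nat_ge (2 * R / s)
  refine ⟨Set.Icc (-N, -N) (N, N), Set.finite_Icc _ _, fun x hx p hp => ?_⟩
  refine mem_box_of_norm_emb_le (le_trans ?_ hN)
  rw [le_div_iff₀ hs]
  calc ‖emb p‖ * s = ‖(x + s • emb p) - x‖ := by
        rw [add_sub_cancel_left, norm_smul, Real.norm_of_nonneg hs.le, mul_comm]
    _ ≤ ‖x + s • emb p‖ + ‖x‖ := norm_sub_le _ _
    _ ≤ 2 * R := by linarith [hR _ hp, hR x hx]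

/-- **One finite action sequence solves all discretized problems at scale `m`.**
Let `X ⊆ ℝ²` be compact and connected with nonempty interior, admitting a globally
connected grid representation with sufficient scaling factor `η`; let `x_G ∈ int X`,
`r > 0`, `m ≥ η`, and assume the discretized goal set meets `int X` for every initial
state.  Then there is a single finite action sequence over the step-`2^{−m}` actions
such that, executed from any `x_I ∈ int X` under the stay-put dynamics on
`X_grid(x_I, m)`, the trajectory visits a point of `x_G(x_I, m)`. -/
theorem stmt15 (X : Set E2) (hcomp : IsCompact X) (hconn : IsConnected X)
    (hint : (interior X).Nonempty) (η : ℕ)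
    (hGCGR : ∀ m' : ℕ, η ≤ m' → ∀ xI ∈ interior X,
      GridConnected (grid X xI m') ((2 : ℝ) ^ (-(m' : ℤ))))
    (xG : E2) (hxG : xG ∈ interior X) (r : ℝ) (hr : 0 < r) (m : ℕ) (hm : η ≤ m)
    (hgoal : ∀ xI ∈ interior X, (goalSet xG r xI m ∩ interior X).Nonempty) :
    ∃ us : List E2, (∀ u ∈ us, u ∈ act m) ∧
      ∀ xI ∈ interior X, ∃ k ≤ us.length,
        (us.take k).foldl (fgrid (grid X xI m)) xI ∈ goalSet xG r xI m := by
  have hs : 0 < (2 : ℝ) ^ (-(m : ℤ)) := by positivity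
  let S : E2 → Set (ℤ × ℤ) := fun x => latticeCoords (interior X) x ((2 : ℝ) ^ (-(m : ℤ)))
  let T : E2 → Set (ℤ × ℤ) := fun x =>
    latticeCoords (interior X ∩ Metric.ball xG r) x ((2 : ℝ) ^ (-(m : ℤ)))
  obtain ⟨B, hB, hSB⟩ := exists_finite_latticeCoords_subset
    (hcomp.isBounded.subset interior_subset) hs
  have hfin : ((fun x => (S x, T x)) '' interior X).Finite := by
    refine (hB.finite_subsets.prod hB.finite_subsets).subset ?_
    rintro _ ⟨x, hx, rfl⟩
    exact ⟨hSB x hx, fun p hp => hSB x hx hp.1⟩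
  obtain ⟨w, hw, hwF⟩ := exists_common_word hfin
    (by
      rintro _ ⟨x, hx, rfl⟩
      simpa [S, latticeCoords, emb_zero] using hx)
    (by
      rintro _ ⟨x, hx, rfl⟩ p hp
      obtain ⟨_, ⟨hball, q, rfl⟩, hq⟩ := hgoal x hx
      obtain ⟨w, hw, hwq⟩ := exists_word_of_gridConnected (hGCGR m hm x hx) hp hq
      refine ⟨w, hw, ?_⟩
      rw [hwq]
      exact ⟨hq, hball⟩)
  refine ⟨w.map fun v => (2 : ℝ) ^ (-(m : ℤ)) • emb v, ?_, fun x hx => ?_⟩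
  · intro u hu
    obtain ⟨v, hv, rfl⟩ := List.mem_map.1 hu
    exact ⟨v, hw v hv, rfl⟩
  · obtain ⟨k, hk, hkT⟩ := hwF _ ⟨x, hx, rfl⟩
    refine ⟨k, by rwa [List.length_map], ?_⟩
    have hfold := foldl_fgrid X x m (w.take k) 0
    rw [emb_zero, smul_zero, add_zero] at hfold
    rw [← List.map_take, hfold]
    exact ⟨hkT.2, _, rfl⟩
end

section
/- Let X ⊂ ℝ² be compact with nonempty interior such that the closure of ℝ² ∖ X has reach at least p for some p > 0. Define X_{p/2} := {x ∈ X : dist(x, ℝ² ∖ X) > p/2}. Then for every z ∈ int X there exists a point z_p in the closure of X_{p/2} with ‖z − z_p‖ < p/2, and the open ball B_{p/2}(z_p) of radius p/2 centered at z_p is contained in int X. -/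
/-- A set `E ⊆ ℝ²` has reach at least `p > 0` if every point at distance `< p`
from `E` has a unique nearest point in `E`. -/
def HasReachGE (E : Set E2) (p : ℝ) : Prop :=
  ∀ y : E2, Metric.infDist y E < p →
    ∃! z : E2, z ∈ E ∧ dist y z = Metric.infDist y E

open Metric in
/-- If `x ∉ E` has a unique nearest point in the closed set `E`, then the distance to `E` grows
with slope arbitrarily close to `1` at `x`. -/
theorem exists_infDist_ge_add_mul_dist {V : Type*} [NormedAddCommGroup V]
    [InnerProductSpace ℝ V] [ProperSpace V] {E : Set V} (hE : IsClosed E) {x : V}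
    (hx : 0 < infDist x E) (hu : ∃! q : V, q ∈ E ∧ dist x q = infDist x E)
    {ε : ℝ} (hε : 0 < ε) (hε1 : ε < 1) {ρ : ℝ} (hρ : 0 < ρ) :
    ∃ y : V, 0 < dist y x ∧ dist y x < ρ ∧
      infDist x E + (1 - ε) * dist y x ≤ infDist y E := by
  obtain ⟨q, ⟨hqE, hq⟩, hquniq⟩ := hu
  set d := infDist x E with hd
  have hnorm : ‖x - q‖ = d := by rw [← dist_eq_norm, hq]
  set v : V := d⁻¹ • (x - q) with hv
  have hvnorm : ‖v‖ = 1 := by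
    rw [hv, norm_smul, hnorm, Real.norm_of_nonneg (by positivity)]
    field_simp
  have hvq : inner ℝ v (x - q) = d := by
    rw [hv, real_inner_smul_left, real_inner_self_eq_norm_sq, hnorm]
    field_simp
  set K : Set V := E ∩ {w | inner ℝ v (x - w) ≤ (1 - ε) * d} with hK
  have hKclosed : IsClosed K :=
    hE.inter (isClosed_le (by fun_prop) continuous_const)
  obtain ⟨δ, hδ, hδK⟩ : ∃ δ > 0, ∀ w ∈ K, d + δ ≤ dist x w := by
    rcases K.eq_empty_or_nonempty with h | h
    · exact ⟨1, one_pos, by simp [h]⟩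
    · obtain ⟨w, hwK, hw⟩ := hKclosed.exists_infDist_eq_dist h x
      have hle : d ≤ dist x w := infDist_le_dist_of_mem hwK.1
      have hne : d ≠ dist x w := by
        intro heq
        have hwq := hquniq w ⟨hwK.1, heq.symm⟩
        have h2 : inner ℝ v (x - w) ≤ (1 - ε) * d := hwK.2
        rw [hwq, hvq] at h2
        nlinarith
      refine ⟨dist x w - d, sub_pos.2 (lt_of_le_of_ne hle hne), fun w' hw' => ?_⟩
      have := infDist_le_dist_of_mem (x := x) hw'
      linarith
  set s : ℝ := min (δ / 3) (ρ / 2) with hs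
  have hs0 : 0 < s := by positivity
  have hsδ : s ≤ δ / 3 := min_le_left _ _
  have hsρ : s ≤ ρ / 2 := min_le_right _ _
  have hdist : dist (x + s • v) x = s := by
    rw [dist_eq_norm, add_sub_cancel_left, norm_smul, hvnorm, Real.norm_of_nonneg hs0.le, mul_one]
  refine ⟨x + s • v, by rwa [hdist], by rw [hdist]; linarith, ?_⟩
  rw [hdist]
  obtain ⟨w, hwE, hw⟩ := hE.exists_infDist_eq_dist ⟨q, hqE⟩ (x + s • v)
  have hxw : d ≤ dist x w := infDist_le_dist_of_mem hwE
  have hwlt : dist x w < d + δ := by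
    have h1 : infDist (x + s • v) E ≤ d + dist (x + s • v) x := infDist_le_infDist_add_dist
    have h2 := dist_triangle_left x w (x + s • v)
    linarith
  have hin : (1 - ε) * d < inner ℝ v (x - w) := by
    by_contra! hcon
    exact absurd (hδK w ⟨hwE, hcon⟩) (not_le.2 hwlt)
  rw [hw, dist_eq_norm]
  rw [dist_eq_norm] at hxw
  have hexp : ‖x + s • v - w‖ ^ 2 = ‖x - w‖ ^ 2 + 2 * (s * inner ℝ v (x - w)) + s ^ 2 := by
    rw [show x + s • v - w = (x - w) + s • v by abel, norm_add_sq_real, real_inner_smul_right,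
      norm_smul, hvnorm, Real.norm_of_nonneg hs0.le, mul_one, real_inner_comm]
  refine (pow_le_pow_iff_left₀ (by nlinarith) (norm_nonneg _) two_ne_zero).1 ?_
  rw [hexp]
  have h1 : d ^ 2 ≤ ‖x - w‖ ^ 2 := pow_le_pow_left₀ hx.le hxw 2
  have h2 : s * ((1 - ε) * d) ≤ s * inner ℝ v (x - w) := mul_le_mul_of_nonneg_left hin.le hs0.le
  have h3 : ((1 - ε) * s) ^ 2 ≤ s ^ 2 :=
    pow_le_pow_left₀ (mul_nonneg (by linarith) hs0.le) (by nlinarith) 2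
  nlinarith

open Metric in
/-- If every point at distance `< p` from the closed set `E` has a unique nearest point in `E`,
then from any `z ∉ E` the distance to `E` can be increased at unit rate up to the value `p`. -/
theorem exists_dist_le_infDist_ge {V : Type*} [NormedAddCommGroup V]
    [InnerProductSpace ℝ V] [ProperSpace V] {E : Set V} (hE : IsClosed E) {p : ℝ}
    (hu : ∀ y : V, infDist y E < p → ∃! q : V, q ∈ E ∧ dist y q = infDist y E)
    {z : V} (hz : 0 < infDist z E) {r : ℝ} (hr : 0 ≤ r) (hrp : infDist z E + r ≤ p) :
    ∃ m : V, dist m z ≤ r ∧ infDist z E + r ≤ infDist m E := by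
  have hcont : Continuous fun x : V => infDist x E := continuous_infDist_pt E
  have key : ∀ ε : ℝ, 0 < ε → ε < 1 →
      ∃ x ∈ closedBall z r, infDist z E + (1 - ε) * r ≤ infDist x E := by
    intro ε hε hε1
    set S : Set V := closedBall z r ∩ {x | infDist z E + (1 - ε) * dist x z ≤ infDist x E} with hS
    have hSc : IsCompact S :=
      (isCompact_closedBall z r).inter_right (isClosed_le (by fun_prop) hcont)
    have hSne : S.Nonempty := ⟨z, mem_closedBall_self hr, by simp⟩
    obtain ⟨x, hxS, hmax⟩ := hSc.exists_isMaxOn hSne hcont.continuousOn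
    have hxr : dist x z ≤ r := hxS.1
    have hxd : infDist z E + (1 - ε) * dist x z ≤ infDist x E := hxS.2
    refine ⟨x, hxS.1, ?_⟩
    rcases hxr.eq_or_lt with h | h
    · rwa [h] at hxd
    exfalso
    have hle : infDist x E ≤ infDist z E + dist x z := infDist_le_infDist_add_dist
    have hx0 : 0 < infDist x E := by
      have : 0 ≤ (1 - ε) * dist x z := mul_nonneg (by linarith) dist_nonneg
      linarith
    obtain ⟨y, hy0, hyρ, hy⟩ := exists_infDist_ge_add_mul_dist hE hx0
      (hu x (by linarith)) hε hε1 (sub_pos.2 h)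
    have htri := dist_triangle y x z
    have hyS : y ∈ S := by
      refine ⟨mem_closedBall.2 (by linarith), ?_⟩
      have := mul_le_mul_of_nonneg_left htri (by linarith : (0 : ℝ) ≤ 1 - ε)
      show infDist z E + (1 - ε) * dist y z ≤ infDist y E
      linarith
    have h1 : infDist y E ≤ infDist x E := hmax hyS
    have h2 : 0 < (1 - ε) * dist y x := mul_pos (by linarith) hy0
    linarith
  obtain ⟨m, hm, hmax⟩ := (isCompact_closedBall z r).exists_isMaxOn
    ⟨z, mem_closedBall_self hr⟩ hcont.continuousOn
  refine ⟨m, hm, le_of_forall_pos_le_add fun η hη => ?_⟩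
  have hε : 0 < min (1 / 2) (η / (r + 1)) := by positivity
  obtain ⟨x, hx, hxd⟩ := key _ hε ((min_le_left _ _).trans_lt (by norm_num))
  have h1 : infDist x E ≤ infDist m E := hmax hx
  have h2 : min (1 / 2) (η / (r + 1)) * (r + 1) ≤ η :=
    (le_div_iff₀ (by positivity)).1 (min_le_right _ _)
  nlinarith

/-- **Interior points are close to the deep interior.**  Let `X ⊆ ℝ²` be compact with
nonempty interior such that the closure of `ℝ² ∖ X` has reach at least `p > 0`, and let
`X_{p/2} := {x ∈ X : dist(x, ℝ² ∖ X) > p/2}`.  Then every `z ∈ int X` admits a point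
`z_p` in the closure of `X_{p/2}` with `‖z − z_p‖ < p/2` such that the open ball
`B_{p/2}(z_p)` is contained in `int X`. -/
theorem stmt16 (X : Set E2) (hcomp : IsCompact X) (hint : (interior X).Nonempty)
    (p : ℝ) (hp : 0 < p) (hreach : HasReachGE (closure Xᶜ) p) :
    ∀ z ∈ interior X, ∃ zp ∈ closure {x ∈ X | p / 2 < Metric.infDist x Xᶜ},
      dist z zp < p / 2 ∧ Metric.ball zp (p / 2) ⊆ interior X := by
  intro z hz
  have hne : (closure Xᶜ).Nonempty := by
    refine Set.Nonempty.closure (Set.nonempty_compl.2 fun h => ?_)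
    exact noncompact_univ E2 (h ▸ hcomp)
  have hz0 : 0 < Metric.infDist z (closure Xᶜ) := by
    refine (isClosed_closure.notMem_iff_infDist_pos hne).1 ?_
    rw [closure_compl]
    exact fun h => h hz
  have hball : ∀ y : E2, p / 2 ≤ Metric.infDist y (closure Xᶜ) →
      Metric.ball y (p / 2) ⊆ interior X := by
    intro y hy w hw
    by_contra hcon
    have hwE : w ∈ closure Xᶜ := by rwa [closure_compl]
    have h1 := Metric.infDist_le_dist_of_mem (x := y) hwE
    rw [Metric.mem_ball'] at hw
    linarith
  have hdeep : ∀ y : E2, p / 2 < Metric.infDist y (closure Xᶜ) →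
      y ∈ {x ∈ X | p / 2 < Metric.infDist x Xᶜ} := by
    intro y hy
    exact ⟨interior_subset (hball y hy.le (Metric.mem_ball_self (by positivity))),
      by rwa [Metric.infDist_closure] at hy⟩
  rcases lt_or_ge (p / 2) (Metric.infDist z (closure Xᶜ)) with h | h
  · exact ⟨z, subset_closure (hdeep z h), by rw [dist_self]; positivity, hball z h.le⟩
  obtain ⟨m, hmz, hm⟩ := exists_dist_le_infDist_ge isClosed_closure hreach hz0
    (sub_nonneg.2 h) (by linarith)
  rw [add_sub_cancel] at hm
  have hmeq : Metric.infDist m (closure Xᶜ) = p / 2 := by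
    have : Metric.infDist m (closure Xᶜ) ≤ Metric.infDist z (closure Xᶜ) + dist m z :=
      Metric.infDist_le_infDist_add_dist
    linarith
  refine ⟨m, Metric.mem_closure_iff.2 fun ε hε => ?_, by rw [dist_comm]; linarith, hball m hm⟩
  have hr : 0 < min (ε / 2) (p / 2) := by positivity
  obtain ⟨y, hym, hy⟩ := exists_dist_le_infDist_ge isClosed_closure hreach
    (by linarith : 0 < Metric.infDist m (closure Xᶜ)) hr.le
    (by linarith [min_le_right (ε / 2) (p / 2)])
  refine ⟨y, hdeep y (by linarith), ?_⟩
  rw [dist_comm]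
  linarith [min_le_left (ε / 2) (p / 2)]
end
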